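/- arXiv:2405.18987 — 10 statements merged into one kernel-verified Lean document; each statement's English description precedes it below -/
import Mathlib

section
/- Let D be an invertible diagonal real n×n matrix and set Φ̃ := (I−B)^{-1}D. Then for all indices r < s in {1,…,n}, the total path-specific effect of all paths from x_r to x_s satisfies Q_1(P_{x_r,x_s}) = Φ̃_{s,r}·(Φ̃_{r,r})^{-1}. -/
open Matrix Finset

namespace TCA

variable {n m : ℕ}

/-- Weight of the tail of a path after a given previous index:
for `prev` and `[k₁, …, k_t]` this is `B k₁ prev * B k₂ k₁ * ⋯ * B k_t k_{t-1}`. -/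
def tailWeight (B : Matrix (Fin n) (Fin n) ℝ) : Fin n → List (Fin n) → ℝ
  | _, [] => 1
  | prev, k :: rest => B k prev * tailWeight B k rest

/-- Weight of a shock-to-variable path `[k₀, …, k_t]` for shock `i`:
`Ω k₀ i * B k₁ k₀ * ⋯ * B k_t k_{t−1}`. -/
def shockListWeight (B : Matrix (Fin n) (Fin n) ℝ) (Ω : Matrix (Fin n) (Fin m) ℝ)
    (i : Fin m) : List (Fin n) → ℝ
  | [] => 0
  | k :: rest => Ω k i * tailWeight B k rest

/-- Weight of a variable-to-variable path `[k₀, …, k_t]`: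
`B k₁ k₀ * ⋯ * B k_t k_{t−1}` (equal to `1` for a single-element path). -/
def varListWeight (B : Matrix (Fin n) (Fin n) ℝ) : List (Fin n) → ℝ
  | [] => 0
  | k :: rest => tailWeight B k rest

/-- A path from the shock to `x_j`, identified with its (nonempty) set of indices:
a strictly increasing sequence ending at `j` is exactly a finite set containing `j`
with all elements `≤ j`. -/
def PathTo (j : Fin n) (S : Finset (Fin n)) : Prop := j ∈ S ∧ ∀ k ∈ S, k ≤ j

/-- A path from `x_r` to `x_s`, identified with its set of indices: a strictly
increasing sequence starting at `r` and ending at `s`. -/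
def PathBetween (r s : Fin n) (S : Finset (Fin n)) : Prop :=
  r ∈ S ∧ s ∈ S ∧ ∀ k ∈ S, r ≤ k ∧ k ≤ s

instance (j : Fin n) : DecidablePred (PathTo j) := fun _ => by
  unfold PathTo; infer_instance

instance (r s : Fin n) : DecidablePred (PathBetween r s) := fun _ => by
  unfold PathBetween; infer_instance

/-- The set `P_{ε_i, x_j}` of all paths from the shock to `x_j`. -/
def allPathsTo (j : Fin n) : Finset (Finset (Fin n)) :=
  Finset.univ.filter (PathTo j)

/-- The set `P_{x_r, x_s}` of all paths from `x_r` to `x_s`. -/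
def allPathsBetween (r s : Fin n) : Finset (Finset (Fin n)) :=
  Finset.univ.filter (PathBetween r s)

/-- Weight of a shock-to-variable path given as a set of indices (the weight of its
strictly increasing enumeration). -/
def wShock (B : Matrix (Fin n) (Fin n) ℝ) (Ω : Matrix (Fin n) (Fin m) ℝ)
    (i : Fin m) (S : Finset (Fin n)) : ℝ :=
  shockListWeight B Ω i (S.sort (· ≤ ·))

/-- Weight of a variable-to-variable path given as a set of indices. -/
def wVar (B : Matrix (Fin n) (Fin n) ℝ) (S : Finset (Fin n)) : ℝ :=
  varListWeight B (S.sort (· ≤ ·))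

/-- Total path-specific effect `Q_ξ(P) = ξ · Σ_{p ∈ P} weight(p)`. -/
def Q (ξ : ℝ) (w : Finset (Fin n) → ℝ) (P : Finset (Finset (Fin n))) : ℝ :=
  ξ * ∑ p ∈ P, w p


/-- Putting a smaller index `r` in front of a path starting at `k` multiplies its weight by
`B k r`. -/
theorem wVar_insert (B : Matrix (Fin n) (Fin n) ℝ) {r k s : Fin n} (hrk : r < k)
    {S : Finset (Fin n)} (hS : PathBetween k s S) :
    wVar B (insert r S) = B k r * wVar B S := by
  obtain ⟨hk, -, hS⟩ := hS
  have hr : r ∉ S := fun h => absurd (hS r h).1 (not_le.2 hrk)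
  have hsort : S.sort (· ≤ ·) = k :: (S.erase k).sort (· ≤ ·) := by
    conv_lhs => rw [← insert_erase hk]
    exact sort_insert (· ≤ ·) (fun b hb => (hS b (mem_of_mem_erase hb)).1) (notMem_erase k S)
  have hsort' : (insert r S).sort (· ≤ ·) = r :: S.sort (· ≤ ·) :=
    sort_insert (· ≤ ·) (fun b hb => hrk.le.trans (hS b hb).1) hr
  simp only [wVar, hsort', hsort, varListWeight, tailWeight]

theorem mem_allPathsBetween {r s : Fin n} {S : Finset (Fin n)} :
    S ∈ allPathsBetween r s ↔ PathBetween r s S := by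
  simp [allPathsBetween]

theorem allPathsBetween_of_lt {r s : Fin n} (h : s < r) : allPathsBetween r s = ∅ := by
  refine eq_empty_of_forall_notMem fun S hS => ?_
  obtain ⟨hr, -, hS⟩ := mem_allPathsBetween.1 hS
  exact absurd (hS r hr).2 (not_le.2 h)

theorem allPathsBetween_self (r : Fin n) : allPathsBetween r r = {{r}} := by
  ext S
  rw [mem_allPathsBetween, mem_singleton]
  constructor
  · rintro ⟨hr, -, hS⟩
    exact eq_singleton_iff_unique_mem.2 ⟨hr, fun k hk => le_antisymm (hS k hk).2 (hS k hk).1⟩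
  · rintro rfl
    simp [PathBetween]

theorem sum_wVar_self (B : Matrix (Fin n) (Fin n) ℝ) (r : Fin n) :
    ∑ S ∈ allPathsBetween r r, wVar B S = 1 := by
  simp [allPathsBetween_self, wVar, varListWeight, tailWeight]

/-- Decomposition of the paths from `r` to `s` by the second index they visit. -/
theorem sum_wVar_of_lt (B : Matrix (Fin n) (Fin n) ℝ) {r s : Fin n} (hrs : r < s) :
    ∑ S ∈ allPathsBetween r s, wVar B S
      = ∑ k ∈ Ioi r, B k r * ∑ S ∈ allPathsBetween k s, wVar B S := by
  simp_rw [mul_sum]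
  rw [sum_sigma']
  symm
  refine sum_bij (fun p _ => insert r p.2) ?_ ?_ ?_ ?_
  · rintro ⟨k, S⟩ h
    simp only [mem_sigma, mem_Ioi, mem_allPathsBetween] at h ⊢
    obtain ⟨hrk, -, hs, hS⟩ := h
    refine ⟨mem_insert_self r S, mem_insert_of_mem hs, fun j hj => ?_⟩
    rcases mem_insert.1 hj with rfl | hj
    · exact ⟨le_rfl, hrs.le⟩
    · exact ⟨hrk.le.trans (hS j hj).1, (hS j hj).2⟩
  · rintro ⟨k, S⟩ h ⟨l, T⟩ h' heq
    simp only [mem_sigma, mem_Ioi, mem_allPathsBetween] at h h' heq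
    obtain ⟨hrk, hk, -, hS⟩ := h
    obtain ⟨hrl, hl, -, hT⟩ := h'
    have hrS : r ∉ S := fun h => absurd (hS r h).1 (not_le.2 hrk)
    have hrT : r ∉ T := fun h => absurd (hT r h).1 (not_le.2 hrl)
    obtain rfl : S = T := by rw [← erase_insert hrS, heq, erase_insert hrT]
    obtain rfl : k = l := le_antisymm (hS l hl).1 (hT k hk).1
    rfl
  · intro S h
    obtain ⟨hr, hs, hS⟩ := mem_allPathsBetween.1 h
    have hne : (S.erase r).Nonempty := ⟨s, mem_erase.2 ⟨hrs.ne', hs⟩⟩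
    have hmin := mem_erase.1 (min'_mem _ hne)
    refine ⟨⟨(S.erase r).min' hne, S.erase r⟩, ?_, insert_erase hr⟩
    simp only [mem_sigma, mem_Ioi, mem_allPathsBetween]
    exact ⟨lt_of_le_of_ne (hS _ hmin.2).1 hmin.1.symm, min'_mem _ hne,
      mem_erase.2 ⟨hrs.ne', hs⟩,
      fun j hj => ⟨min'_le _ j hj, (hS j (mem_of_mem_erase hj)).2⟩⟩
  · rintro ⟨k, S⟩ h
    simp only [mem_sigma, mem_Ioi, mem_allPathsBetween] at h
    exact (wVar_insert B h.1 h.2).symm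

/-- The entries of `(I − B)⁻¹` are the sums of the path weights. -/
theorem inv_one_sub_apply (B : Matrix (Fin n) (Fin n) ℝ)
    (hB : ∀ j k : Fin n, j ≤ k → B j k = 0) (r s : Fin n) :
    (1 - B)⁻¹ s r = ∑ S ∈ allPathsBetween r s, wVar B S := by
  set M : Matrix (Fin n) (Fin n) ℝ :=
    Matrix.of fun s r => ∑ S ∈ allPathsBetween r s, wVar B S with hM
  suffices h : M * (1 - B) = 1 by rw [inv_eq_left_inv h, hM, of_apply]
  suffices h : M = 1 + M * B by rw [mul_sub, mul_one, sub_eq_iff_eq_add]; exact h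
  ext s r
  have hsum : (M * B) s r = ∑ k ∈ Ioi r, B k r * ∑ S ∈ allPathsBetween k s, wVar B S := by
    rw [mul_apply]
    symm
    refine sum_subset_zero_on_sdiff (subset_univ _) (fun k hk => ?_) fun k _ => mul_comm _ _
    have hkr : k ≤ r := by simpa using hk
    rw [hB k r hkr, mul_zero]
  rw [Matrix.add_apply, hsum]
  rcases lt_or_ge r s with hrs | hsr
  · rw [one_apply_ne hrs.ne', zero_add, ← sum_wVar_of_lt B hrs, hM, of_apply]
  · have hzero : ∑ k ∈ Ioi r, B k r * ∑ S ∈ allPathsBetween k s, wVar B S = 0 :=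
      sum_eq_zero fun k hk => by
        rw [allPathsBetween_of_lt (hsr.trans_lt (mem_Ioi.1 hk)), sum_empty, mul_zero]
    rw [hzero, add_zero, hM, of_apply]
    rcases hsr.eq_or_lt with rfl | hsr
    · rw [sum_wVar_self, one_apply_eq]
    · rw [allPathsBetween_of_lt hsr, sum_empty, one_apply_ne hsr.ne]

/-- with `Φ̃ = (I − B)⁻¹ D` for an invertible diagonal `D`, for `r < s`
the total path-specific effect of all paths from `x_r` to `x_s` is
`Φ̃_{s,r} · (Φ̃_{r,r})⁻¹`. -/
theorem var_paths_cholesky_ratio (n : ℕ) (hn : 0 < n)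
    (B D : Matrix (Fin n) (Fin n) ℝ)
    (hB : ∀ j k : Fin n, j ≤ k → B j k = 0)
    (hD : D.IsDiag) (hDu : IsUnit D)
    (r s : Fin n) (hrs : r < s) :
    Q 1 (wVar B) (allPathsBetween r s)
      = ((1 - B)⁻¹ * D) s r * (((1 - B)⁻¹ * D) r r)⁻¹ := by
  have hDr : D r r ≠ 0 := by
    rw [← hD.diagonal_diag] at hDu
    exact (Pi.isUnit_iff.1 (isUnit_diagonal.1 hDu) r).ne_zero
  have hmul : ∀ j : Fin n, ((1 - B)⁻¹ * D) j r = (1 - B)⁻¹ j r * D r r := fun j => by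
    rw [← hD.diagonal_diag, mul_diagonal, diagonal_apply_eq]
  rw [hmul, hmul, inv_one_sub_apply B hB, inv_one_sub_apply B hB, sum_wVar_self, one_mul,
    mul_assoc, mul_inv_cancel₀ hDr, mul_one, Q, one_mul]

end TCA
end

section
/- If P^(1), …, P^(k) is a partition of the set P_{ε_i,x_j} of all paths from ε_i to x_j (the sets are pairwise disjoint and their union is P_{ε_i,x_j}), then Σ_{m=1}^{k} Q_ξ(P^(m)) = ξ·Φ_{j,i}; that is, the transmission effects of disjoint transmission channels that exhaust all paths decompose the total effect. -/
open Matrix Finset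

namespace TCA

variable {n m : ℕ}

theorem tailWeight_append_pair (B : Matrix (Fin n) (Fin n) ℝ) (k j : Fin n)
    (l : List (Fin n)) (p : Fin n) :
    tailWeight B p (l ++ [k, j]) = B j k * tailWeight B p (l ++ [k]) := by
  induction l generalizing p with
  | nil => simp [tailWeight, mul_comm]
  | cons a l ih => simp only [List.cons_append, tailWeight, ih]; ring

theorem shockListWeight_append_pair (B : Matrix (Fin n) (Fin n) ℝ)
    (Ω : Matrix (Fin n) (Fin m) ℝ) (i : Fin m) (k j : Fin n) (l : List (Fin n)) :
    shockListWeight B Ω i (l ++ [k, j]) = B j k * shockListWeight B Ω i (l ++ [k]) := by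
  cases l with
  | nil => simp [shockListWeight, tailWeight, mul_comm]
  | cons a l =>
    simp only [List.cons_append, shockListWeight, tailWeight_append_pair]; ring

theorem sort_insert_of_forall_lt {α : Type*} [LinearOrder α] (T : Finset α) (j : α)
    (h : ∀ k ∈ T, k < j) :
    (insert j T).sort (· ≤ ·) = T.sort (· ≤ ·) ++ [j] := by
  have hj : j ∉ T := fun hj => lt_irrefl _ (h j hj)
  refine List.Perm.eq_of_pairwise' (r := (· ≤ ·)) (Finset.pairwise_sort _ _) ?_ ?_
  · refine List.pairwise_append.2 ⟨Finset.pairwise_sort _ _, List.pairwise_singleton _ _, ?_⟩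
    intro a ha b hb
    rw [List.mem_singleton.1 hb]
    exact (h a ((Finset.mem_sort _).1 ha)).le
  · refine (List.perm_ext_iff_of_nodup (Finset.sort_nodup _ _) ?_).2 fun a => ?_
    · refine List.nodup_append.2 ⟨Finset.sort_nodup _ _, List.nodup_singleton _, ?_⟩
      intro a ha b hb
      rw [List.mem_singleton.1 hb]
      exact (h a ((Finset.mem_sort _).1 ha)).ne
    · simp [or_comm]

theorem mem_allPathsTo {j : Fin n} {S : Finset (Fin n)} :
    S ∈ allPathsTo j ↔ j ∈ S ∧ ∀ k ∈ S, k ≤ j := by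
  simp [allPathsTo, PathTo]

theorem forall_lt_of_mem_allPathsTo {j k : Fin n} (hkj : k < j) {T : Finset (Fin n)}
    (hT : T ∈ allPathsTo k) : ∀ a ∈ T, a < j :=
  fun a ha => ((mem_allPathsTo.1 hT).2 a ha).trans_lt hkj

theorem notMem_of_mem_allPathsTo {j k : Fin n} (hkj : k < j) {T : Finset (Fin n)}
    (hT : T ∈ allPathsTo k) : j ∉ T :=
  fun hj => lt_irrefl _ (forall_lt_of_mem_allPathsTo hkj hT j hj)

theorem wShock_singleton (B : Matrix (Fin n) (Fin n) ℝ) (Ω : Matrix (Fin n) (Fin m) ℝ)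
    (i : Fin m) (j : Fin n) : wShock B Ω i {j} = Ω j i := by
  simp [wShock, shockListWeight, tailWeight]

theorem wShock_insert (B : Matrix (Fin n) (Fin n) ℝ) (Ω : Matrix (Fin n) (Fin m) ℝ)
    (i : Fin m) {j k : Fin n} (hkj : k < j) {T : Finset (Fin n)} (hT : T ∈ allPathsTo k) :
    wShock B Ω i (insert j T) = B j k * wShock B Ω i T := by
  have hsort : T.sort (· ≤ ·) = (T.erase k).sort (· ≤ ·) ++ [k] := by
    obtain ⟨hk, hle⟩ := mem_allPathsTo.1 hT
    rw [← sort_insert_of_forall_lt, Finset.insert_erase hk]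
    exact fun a ha => lt_of_le_of_ne (hle a (Finset.mem_of_mem_erase ha))
      (Finset.ne_of_mem_erase ha)
  rw [wShock, wShock, sort_insert_of_forall_lt T j (forall_lt_of_mem_allPathsTo hkj hT), hsort,
    List.append_assoc]
  exact shockListWeight_append_pair B Ω i k j _

theorem allPathsTo_eq_insert (j : Fin n) :
    allPathsTo j = insert {j} ((Finset.univ.filter (· < j)).biUnion
      fun k => (allPathsTo k).image (insert j)) := by
  ext S
  simp only [Finset.mem_insert, Finset.mem_biUnion, Finset.mem_filter, Finset.mem_univ,
    true_and, Finset.mem_image]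
  constructor
  · intro hS
    obtain ⟨hj, hle⟩ := mem_allPathsTo.1 hS
    rcases (S.erase j).eq_empty_or_nonempty with h | h
    · left
      rw [← Finset.insert_erase hj, h]
      rfl
    · right
      have hmax := Finset.max'_mem _ h
      refine ⟨(S.erase j).max' h, ?_, S.erase j, ?_, Finset.insert_erase hj⟩
      · exact lt_of_le_of_ne (hle _ (Finset.mem_of_mem_erase hmax)) (Finset.ne_of_mem_erase hmax)
      · exact mem_allPathsTo.2 ⟨hmax, fun a ha => Finset.le_max' _ a ha⟩
  · rintro (rfl | ⟨k, hkj, T, hT, rfl⟩)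
    · simp [mem_allPathsTo]
    · refine mem_allPathsTo.2 ⟨Finset.mem_insert_self _ _, fun a ha => ?_⟩
      rcases Finset.mem_insert.1 ha with rfl | ha
      · exact le_rfl
      · exact (forall_lt_of_mem_allPathsTo hkj hT a ha).le

theorem sum_wShock_allPathsTo (B : Matrix (Fin n) (Fin n) ℝ) (Ω : Matrix (Fin n) (Fin m) ℝ)
    (hB : ∀ j k : Fin n, j ≤ k → B j k = 0) (i : Fin m) (j : Fin n) :
    ∑ S ∈ allPathsTo j, wShock B Ω i S =
      Ω j i + ∑ k, B j k * ∑ T ∈ allPathsTo k, wShock B Ω i T := by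
  have hinj {k l : Fin n} (hk : k < j) (hl : l < j) {T U : Finset (Fin n)}
      (hT : T ∈ allPathsTo k) (hU : U ∈ allPathsTo l) (h : insert j T = insert j U) : T = U := by
    rw [← Finset.erase_insert (notMem_of_mem_allPathsTo hk hT), h,
      Finset.erase_insert (notMem_of_mem_allPathsTo hl hU)]
  rw [allPathsTo_eq_insert j, Finset.sum_insert, wShock_singleton, Finset.sum_biUnion]
  · congr 1
    rw [Finset.sum_filter]
    refine Finset.sum_congr rfl fun k _ => ?_
    split_ifs with hk
    · rw [Finset.sum_image fun T hT U hU h => hinj hk hk hT hU h, Finset.mul_sum]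
      exact Finset.sum_congr rfl fun T hT => wShock_insert B Ω i hk hT
    · rw [hB j k (not_lt.1 hk), zero_mul]
  · intro k hk l hl hkl
    refine Finset.disjoint_left.2 fun S hS hS' => hkl ?_
    obtain ⟨T, hT, rfl⟩ := Finset.mem_image.1 hS
    obtain ⟨U, hU, h⟩ := Finset.mem_image.1 hS'
    obtain rfl := hinj (Finset.mem_filter.1 hl).2 (Finset.mem_filter.1 hk).2 hU hT h
    rw [mem_allPathsTo] at hT hU
    exact le_antisymm (hU.2 k hT.1) (hT.2 l hU.1)
  · simp only [Finset.mem_biUnion, Finset.mem_filter, Finset.mem_univ, true_and,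
      Finset.mem_image, not_exists, not_and]
    intro k hk T hT h
    have hkT : k ∈ insert j T := Finset.mem_insert_of_mem (mem_allPathsTo.1 hT).1
    rw [h, Finset.mem_singleton] at hkT
    exact hk.ne hkT

theorem det_one_sub_of_strictly_lower (B : Matrix (Fin n) (Fin n) ℝ)
    (hB : ∀ j k : Fin n, j ≤ k → B j k = 0) : (1 - B).det = 1 := by
  rw [Matrix.det_of_isLowerTriangular]
  · simp [hB _ _ le_rfl]
  · intro a b hab
    have hlt : a < b := hab
    simp [hB a b hlt.le, hlt.ne]

theorem sum_wShock_allPathsTo_eq_inv_mul (B : Matrix (Fin n) (Fin n) ℝ)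
    (Ω : Matrix (Fin n) (Fin m) ℝ) (hB : ∀ j k : Fin n, j ≤ k → B j k = 0)
    (i : Fin m) (j : Fin n) :
    ∑ S ∈ allPathsTo j, wShock B Ω i S = ((1 - B)⁻¹ * Ω) j i := by
  let F : Matrix (Fin n) (Fin m) ℝ := fun j i => ∑ S ∈ allPathsTo j, wShock B Ω i S
  have hF : (1 - B) * F = Ω := by
    ext a b
    rw [Matrix.sub_mul, Matrix.one_mul, Matrix.sub_apply, Matrix.mul_apply, sub_eq_iff_eq_add]
    exact sum_wShock_allPathsTo B Ω hB b a
  have hdet : IsUnit (1 - B).det := by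
    rw [det_one_sub_of_strictly_lower B hB]
    exact isUnit_one
  have hinv : (1 - B)⁻¹ * Ω = F := by
    rw [← Matrix.nonsing_inv_mul_cancel_left (1 - B) F hdet, hF]
  rw [hinv]

/-- transmission effects of a partition of the set of all paths from
`ε_i` to `x_j` add up to the total effect `ξ · Φ_{j,i}`. -/
theorem partition_decomposes_total_effect (n m : ℕ) (hn : 0 < n) (hm : 0 < m)
    (B : Matrix (Fin n) (Fin n) ℝ) (Ω : Matrix (Fin n) (Fin m) ℝ)
    (hB : ∀ j k : Fin n, j ≤ k → B j k = 0)
    (i : Fin m) (j : Fin n) (ξ : ℝ)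
    (k : ℕ) (P : Fin k → Finset (Finset (Fin n)))
    (hdisj : ∀ a b : Fin k, a ≠ b → Disjoint (P a) (P b))
    (hcover : Finset.univ.biUnion P = allPathsTo j) :
    ∑ a : Fin k, Q ξ (wShock B Ω i) (P a) = ξ * ((1 - B)⁻¹ * Ω) j i := by
  simp only [Q]
  rw [← Finset.mul_sum, ← Finset.sum_biUnion fun a _ b _ hab => hdisj a b hab, hcover,
    sum_wShock_allPathsTo_eq_inv_mul B Ω hB]

end TCA
end

section
/- Let i_1 < i_2 < ⋯ < i_q < j be indices in {1,…,n}, and let P be the set of paths from ε_i to x_j that pass through every one of the variables x_{i_1}, …, x_{i_q}. Then Q_ξ(P) = Q_ξ(P_{ε_i,x_{i_1}}) · Q_1(P_{x_{i_1},x_{i_2}}) · ⋯ · Q_1(P_{x_{i_{q−1}},x_{i_q}}) · Q_1(P_{x_{i_q},x_j}). -/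
open Matrix Finset

namespace TCA

variable {n m : ℕ}

theorem sort_eq_append_cons_of_mem {α : Type*} [LinearOrder α] {S : Finset α} {r : α}
    (hr : r ∈ S) :
    S.sort (· ≤ ·) = (S.filter (· < r)).sort (· ≤ ·) ++ r :: (S.filter (r < ·)).sort (· ≤ ·) := by
  have hsorted : ((S.filter (· < r)).sort (· ≤ ·) ++
      r :: (S.filter (r < ·)).sort (· ≤ ·)).Pairwise (· < ·) := by
    rw [List.pairwise_append, List.pairwise_cons]
    refine ⟨Finset.sortedLT_sort _ |>.pairwise, ⟨?_, Finset.sortedLT_sort _ |>.pairwise⟩, ?_⟩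
    · intro a ha
      simp only [Finset.mem_sort, Finset.mem_filter] at ha
      exact ha.2
    · intro a ha b hb
      simp only [Finset.mem_sort, Finset.mem_filter, List.mem_cons] at ha hb
      rcases hb with rfl | hb
      · exact ha.2
      · exact ha.2.trans hb.2
  refine List.Perm.eq_of_pairwise (le := (· < ·)) (fun a b _ _ h h' => (h.asymm h').elim)
    (Finset.sortedLT_sort S).pairwise hsorted ?_
  rw [List.perm_ext_iff_of_nodup (Finset.sort_nodup _ _) (hsorted.imp fun h => h.ne)]
  intro a
  simp only [Finset.mem_sort, List.mem_append, List.mem_cons, Finset.mem_filter]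
  constructor
  · intro ha
    rcases lt_trichotomy a r with h | h | h
    · exact Or.inl ⟨ha, h⟩
    · exact Or.inr (Or.inl h)
    · exact Or.inr (Or.inr ⟨ha, h⟩)
  · rintro (h | rfl | h)
    exacts [h.1, hr, h.1]

theorem tailWeight_append_cons (B : Matrix (Fin n) (Fin n) ℝ) (p r : Fin n)
    (l t : List (Fin n)) :
    tailWeight B p (l ++ r :: t) = tailWeight B p (l ++ [r]) * tailWeight B r t := by
  induction l generalizing p with
  | nil => simp [tailWeight]
  | cons k l ih => simp only [List.cons_append, tailWeight, ih k, mul_assoc]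

theorem shockListWeight_append_cons (B : Matrix (Fin n) (Fin n) ℝ)
    (Ω : Matrix (Fin n) (Fin m) ℝ) (i : Fin m) (r : Fin n) (l t : List (Fin n)) :
    shockListWeight B Ω i (l ++ r :: t)
      = shockListWeight B Ω i (l ++ [r]) * varListWeight B (r :: t) := by
  cases l with
  | nil => simp [shockListWeight, varListWeight, tailWeight]
  | cons k l =>
    simp only [List.cons_append, shockListWeight, varListWeight,
      tailWeight_append_cons B k r l t, mul_assoc]

/-- The weight of a path through `x_r` is the product of the weights of its two halves. -/
theorem wShock_eq_mul_wVar (B : Matrix (Fin n) (Fin n) ℝ) (Ω : Matrix (Fin n) (Fin m) ℝ)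
    (i : Fin m) {r : Fin n} {S : Finset (Fin n)} (hr : r ∈ S) :
    wShock B Ω i S
      = wShock B Ω i (S.filter (· ≤ r)) * wVar B (S.filter (r ≤ ·)) := by
  have h₁ : r ∈ S.filter (· ≤ r) := by simp [hr]
  have h₂ : r ∈ S.filter (r ≤ ·) := by simp [hr]
  have e₁ : (S.filter (· ≤ r)).filter (· < r) = S.filter (· < r) := by
    ext a; simp only [Finset.mem_filter]; grind
  have e₂ : (S.filter (· ≤ r)).filter (r < ·) = ∅ := by
    ext a; simp only [Finset.mem_filter, Finset.notMem_empty]; grind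
  have e₃ : (S.filter (r ≤ ·)).filter (· < r) = ∅ := by
    ext a; simp only [Finset.mem_filter, Finset.notMem_empty]; grind
  have e₄ : (S.filter (r ≤ ·)).filter (r < ·) = S.filter (r < ·) := by
    ext a; simp only [Finset.mem_filter]; grind
  rw [wShock, wShock, wVar, sort_eq_append_cons_of_mem hr, sort_eq_append_cons_of_mem h₁,
    sort_eq_append_cons_of_mem h₂, e₁, e₂, e₃, e₄, shockListWeight_append_cons]
  simp

/-- Paths to `x_j` through `x_r` and through a set `T` of earlier variables factorise at `x_r`. -/
theorem Q_through_eq_mul (B : Matrix (Fin n) (Fin n) ℝ) (Ω : Matrix (Fin n) (Fin m) ℝ)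
    (i : Fin m) (ξ : ℝ) {r j : Fin n} (hrj : r ≤ j) (T : Finset (Fin n))
    (hT : ∀ k ∈ T, k ≤ r) :
    Q ξ (wShock B Ω i) ((allPathsTo j).filter (fun S => r ∈ S ∧ T ⊆ S))
      = Q ξ (wShock B Ω i) ((allPathsTo r).filter (fun S => T ⊆ S))
        * Q 1 (wVar B) (allPathsBetween r j) := by
  rw [Q, Q, Q, one_mul, mul_assoc, Finset.sum_mul_sum, ← Finset.sum_product']
  congr 1
  refine Finset.sum_nbij' (fun S => (S.filter (· ≤ r), S.filter (r ≤ ·)))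
    (fun p => p.1 ∪ p.2) ?_ ?_ ?_ ?_ ?_
  · intro S hS
    simp only [allPathsTo, allPathsBetween, PathTo, PathBetween, Finset.mem_filter,
      Finset.mem_univ, true_and, Finset.mem_product, Finset.subset_iff] at hS ⊢
    grind
  · rintro ⟨S₁, S₂⟩ hS
    simp only [allPathsTo, allPathsBetween, PathTo, PathBetween, Finset.mem_filter,
      Finset.mem_univ, true_and, Finset.mem_product, Finset.subset_iff,
      Finset.mem_union] at hS ⊢
    grind
  · intro S _
    ext a
    simp only [Finset.mem_union, Finset.mem_filter]
    grind
  · rintro ⟨S₁, S₂⟩ hS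
    simp only [allPathsTo, allPathsBetween, PathTo, PathBetween, Finset.mem_filter,
      Finset.mem_univ, true_and, Finset.mem_product] at hS
    ext a <;> simp only [Finset.mem_union, Finset.mem_filter] <;> grind
  · intro S hS
    exact wShock_eq_mul_wVar B Ω i (Finset.mem_filter.mp hS).2.1

/-- for indices `v 0 < v 1 < ⋯ < v q < j`, the total path-specific
effect of the paths from `ε_i` to `x_j` passing through every `x_{v a}` factorises
into the product of the successive total effects. -/
theorem multi_through_effect_factorises (n m : ℕ) (hn : 0 < n) (hm : 0 < m)
    (B : Matrix (Fin n) (Fin n) ℝ) (Ω : Matrix (Fin n) (Fin m) ℝ)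
    (hB : ∀ j k : Fin n, j ≤ k → B j k = 0)
    (i : Fin m) (j : Fin n) (ξ : ℝ)
    (q : ℕ) (v : Fin (q + 1) → Fin n) (hv : StrictMono v) (hvj : ∀ a, v a < j) :
    Q ξ (wShock B Ω i) ((allPathsTo j).filter (fun S => ∀ a, v a ∈ S))
      = Q ξ (wShock B Ω i) (allPathsTo (v 0))
        * (∏ a : Fin q, Q 1 (wVar B) (allPathsBetween (v a.castSucc) (v a.succ)))
        * Q 1 (wVar B) (allPathsBetween (v (Fin.last q)) j) := by
  clear hn hm hB
  induction q generalizing j with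
  | zero =>
    have h := Q_through_eq_mul B Ω i ξ (hvj 0).le ∅ (by simp)
    simpa [Fin.forall_fin_one] using h
  | succ q ih =>
    have hlast (a : Fin (q + 1)) : v a.castSucc < v (Fin.last (q + 1)) :=
      hv (Fin.castSucc_lt_last a)
    have h := Q_through_eq_mul B Ω i ξ (hvj (Fin.last (q + 1))).le
      (Finset.univ.image fun a : Fin (q + 1) => v a.castSucc)
      (by simpa using fun a => (hlast a).le)
    have ih' := ih (v (Fin.last (q + 1))) (fun a => v a.castSucc)
      (hv.comp Fin.strictMono_castSucc) hlast
    simp only [Finset.image_subset_iff, Finset.mem_univ, forall_const] at h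
    rw [ih'] at h
    simp only [Fin.forall_fin_succ' (n := q + 1), and_comm (b := v (Fin.last (q + 1)) ∈ _)]
    rw [h, Fin.prod_univ_castSucc (n := q)]
    simp only [Fin.succ_castSucc, Fin.succ_last, Fin.castSucc_zero, mul_assoc]

end TCA
end

section
/- Fix indices k < j in {1,…,n}. Define B̄ to equal B except that B̄_{r,s} := 0 whenever r > k and s < k, and define Ω̄ to equal Ω except that Ω̄_{r,i} := 0 whenever r > k. Then for every path p from ε_i to x_j: if p passes through x_k, the weight of p computed with (B̄,Ω̄) equals its weight computed with (B,Ω); and if p does not pass through x_k, the weight of p computed with (B̄,Ω̄) is 0. Consequently Σ_{p ∈ P_{ε_i,x_j}} weight_{(B̄,Ω̄)}(p) = Σ_{p ∈ P_{ε_i,x_j}, p through x_k} weight_{(B,Ω)}(p). -/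
open Matrix Finset

namespace TCA

variable {n m : ℕ}

/-- Deleting the edges that jump over `k` does not change the weight of an increasing path
tail that starts at or after `k`, or visits `k`. -/
theorem tailWeight_eq_of_mem {B Bbar : Matrix (Fin n) (Fin n) ℝ} {k : Fin n}
    (hBbar : ∀ r s : Fin n, Bbar r s = if k < r ∧ s < k then 0 else B r s)
    (l : List (Fin n)) (prev : Fin n) (hl : (prev :: l).Pairwise (· < ·))
    (hk : k ≤ prev ∨ k ∈ l) :
    tailWeight Bbar prev l = tailWeight B prev l := by
  induction l generalizing prev with
  | nil => rfl
  | cons a t ih =>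
    obtain ⟨hprev, ht⟩ := List.pairwise_cons.1 hl
    have hpa : prev < a := hprev a (by simp)
    have hat : ∀ b ∈ t, a < b := (List.pairwise_cons.1 ht).1
    have hka : k ≤ a ∨ k ∈ t := by
      rcases hk with h | h
      · exact Or.inl (h.trans hpa.le)
      · exact (List.mem_cons.1 h).imp le_of_eq id
    have hedge : ¬(k < a ∧ prev < k) := by
      rintro ⟨h1, h2⟩
      rcases hk with h | h
      · exact absurd h2 h.not_gt
      · rcases List.mem_cons.1 h with rfl | h
        · exact lt_irrefl _ h1
        · exact lt_asymm h1 (hat k h)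
    simp only [tailWeight]
    rw [ih a ht hka, hBbar, if_neg hedge]

/-- Deleting the edges that jump over `k` annihilates every path tail that starts
before `k`, avoids `k`, and visits some vertex beyond `k`. -/
theorem tailWeight_eq_zero_of_notMem {B Bbar : Matrix (Fin n) (Fin n) ℝ} {k j : Fin n}
    (hBbar : ∀ r s : Fin n, Bbar r s = if k < r ∧ s < k then 0 else B r s)
    (hkj : k < j) (l : List (Fin n)) (prev : Fin n) (hprev : prev < k)
    (hk : k ∉ l) (hj : j ∈ l) :
    tailWeight Bbar prev l = 0 := by
  induction l generalizing prev with
  | nil => simp at hj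
  | cons a t ih =>
    simp only [List.mem_cons, not_or] at hk hj
    simp only [tailWeight]
    rcases lt_or_gt_of_ne hk.1 with h | h
    · rw [hBbar, if_pos ⟨h, hprev⟩, zero_mul]
    · rw [ih a h hk.2 (hj.resolve_left (h.trans hkj).ne'), mul_zero]

/-- Edge deletion preserves the weight of every increasing shock path through `k`. -/
theorem shockListWeight_eq_of_mem {B Bbar : Matrix (Fin n) (Fin n) ℝ}
    {Ω Ωbar : Matrix (Fin n) (Fin m) ℝ} {i : Fin m} {k : Fin n}
    (hBbar : ∀ r s : Fin n, Bbar r s = if k < r ∧ s < k then 0 else B r s)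
    (hΩbar : ∀ (r : Fin n) (c : Fin m), Ωbar r c = if k < r ∧ c = i then 0 else Ω r c)
    (l : List (Fin n)) (hl : l.Pairwise (· < ·)) (hk : k ∈ l) :
    shockListWeight Bbar Ωbar i l = shockListWeight B Ω i l := by
  cases l with
  | nil => rfl
  | cons a t =>
    have hka : k ≤ a ∨ k ∈ t := (List.mem_cons.1 hk).imp le_of_eq id
    have hedge : ¬(k < a ∧ i = i) := by
      rintro ⟨h1, -⟩
      rcases List.mem_cons.1 hk with rfl | h
      · exact lt_irrefl _ h1
      · exact lt_asymm h1 ((List.pairwise_cons.1 hl).1 k h)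
    simp only [shockListWeight]
    rw [tailWeight_eq_of_mem hBbar t a hl hka, hΩbar, if_neg hedge]

/-- Edge deletion annihilates every shock path that avoids `k` and visits some vertex
beyond `k`. -/
theorem shockListWeight_eq_zero_of_notMem {B Bbar : Matrix (Fin n) (Fin n) ℝ}
    {Ω Ωbar : Matrix (Fin n) (Fin m) ℝ} {i : Fin m} {k j : Fin n}
    (hBbar : ∀ r s : Fin n, Bbar r s = if k < r ∧ s < k then 0 else B r s)
    (hΩbar : ∀ (r : Fin n) (c : Fin m), Ωbar r c = if k < r ∧ c = i then 0 else Ω r c)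
    (hkj : k < j) (l : List (Fin n)) (hk : k ∉ l) (hj : j ∈ l) :
    shockListWeight Bbar Ωbar i l = 0 := by
  cases l with
  | nil => rfl
  | cons a t =>
    simp only [List.mem_cons, not_or] at hk hj
    simp only [shockListWeight]
    rcases lt_or_gt_of_ne hk.1 with h | h
    · rw [hΩbar, if_pos ⟨h, rfl⟩, zero_mul]
    · rw [tailWeight_eq_zero_of_notMem hBbar hkj t a h hk.2
        (hj.resolve_left (h.trans hkj).ne'), mul_zero]

/-- deleting every edge that bypasses `x_k` (entries `B̄_{r,s} = 0` for
`r > k`, `s < k`, and `Ω̄_{r,i} = 0` for `r > k`) preserves the weight of every path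
through `x_k`, annihilates the weight of every other path, and hence the sum of the
new weights over all paths equals the sum of the old weights over paths through `x_k`. -/
theorem edge_deletion_through (n m : ℕ) (hn : 0 < n) (hm : 0 < m)
    (B Bbar : Matrix (Fin n) (Fin n) ℝ) (Ω Ωbar : Matrix (Fin n) (Fin m) ℝ)
    (hB : ∀ j k : Fin n, j ≤ k → B j k = 0)
    (i : Fin m) (k j : Fin n) (hkj : k < j)
    (hBbar : ∀ r s : Fin n, Bbar r s = if k < r ∧ s < k then 0 else B r s)
    (hΩbar : ∀ (r : Fin n) (c : Fin m), Ωbar r c = if k < r ∧ c = i then 0 else Ω r c) :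
    (∀ S ∈ allPathsTo j,
        (k ∈ S → wShock Bbar Ωbar i S = wShock B Ω i S) ∧
        (k ∉ S → wShock Bbar Ωbar i S = 0)) ∧
    ∑ S ∈ allPathsTo j, wShock Bbar Ωbar i S
      = ∑ S ∈ (allPathsTo j).filter (fun S => k ∈ S), wShock B Ω i S := by
  have hpath : ∀ S ∈ allPathsTo j,
      (k ∈ S → wShock Bbar Ωbar i S = wShock B Ω i S) ∧
      (k ∉ S → wShock Bbar Ωbar i S = 0) := by
    intro S hS
    have hj : j ∈ S := (Finset.mem_filter.1 hS).2.1
    exact ⟨fun hk => shockListWeight_eq_of_mem hBbar hΩbar _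
        (Finset.sortedLT_sort S).pairwise ((Finset.mem_sort _).2 hk),
      fun hk => shockListWeight_eq_zero_of_notMem hBbar hΩbar hkj _
        (fun h => hk ((Finset.mem_sort _).1 h)) ((Finset.mem_sort _).2 hj)⟩
  refine ⟨hpath, ?_⟩
  rw [Finset.sum_filter]
  refine Finset.sum_congr rfl fun S hS => ?_
  split_ifs with hk
  · exact (hpath S hS).1 hk
  · exact (hpath S hS).2 hk

end TCA
end

section
/- Fix j ∈ {1,…,n}, ξ ∈ ℝ, and vectors e_1, …, e_k ∈ {0,ξ}^{η(j)} with Σ_{m=1}^{k} e_m = ξ·𝟙_{η(j)}, where 𝟙_{η(j)} is the all-ones vector. Then Σ_{m=1}^{k} C_j(e_m) = ξ·Φ_{j,i}, where Φ := (I−B)^{-1}Ω; that is, causal effects of assignment vectors that jointly activate every nested chain exactly once decompose the total impulse-response effect. -/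
open Matrix Finset

namespace TCA

/-- The potential-outcome causal-effect functional `C_j` (0-based index `j`,
so `η(j) = 2^j` and the block of coordinates of the assignment vector tracking
the dependence on variable `k < j` is `[2^k − 1, 2^{k+1} − 1)`):
`C_0 a = Ω_{0,i}·a_0` and
`C_{j+1} a = Σ_{k ≤ j} B_{j+1,k} · C_k (a restricted to block k) + Ω_{j+1,i} · a_last`. -/
noncomputable def C {n m : ℕ} (B : Matrix (Fin n) (Fin n) ℝ)
    (Ω : Matrix (Fin n) (Fin m) ℝ) (i : Fin m) :
    (j : ℕ) → j < n → (Fin (2 ^ j) → ℝ) → ℝ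
  | 0, hj, a => Ω ⟨0, hj⟩ i * a ⟨0, by norm_num⟩
  | j + 1, hj, a =>
      (∑ k : Fin (j + 1),
          B ⟨j + 1, hj⟩ ⟨(k : ℕ), Nat.lt_trans k.isLt hj⟩ *
            C B Ω i (k : ℕ) (Nat.lt_trans k.isLt hj)
              (fun t => a ⟨2 ^ (k : ℕ) - 1 + (t : ℕ), by
                have ht := t.isLt
                have h1 : 2 ^ ((k : ℕ) + 1) ≤ 2 ^ (j + 1) :=
                  Nat.pow_le_pow_right (by norm_num)
                    (Nat.succ_le_succ (Nat.le_of_lt_succ k.isLt))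
                have h2 : 2 ^ ((k : ℕ) + 1) = 2 ^ (k : ℕ) * 2 := pow_succ 2 (k : ℕ)
                omega⟩))
        + Ω ⟨j + 1, hj⟩ i *
            a ⟨2 ^ (j + 1) - 1, by
              have h : 0 < 2 ^ (j + 1) := pow_pos (by norm_num) (j + 1)
              omega⟩
  termination_by j _ _ => j
  decreasing_by exact k.isLt

theorem sum_fin_eq_sum_fin_of_le {M : Type*} [AddCommMonoid M] {p n : ℕ} (hpn : p ≤ n)
    (f : Fin n → M) (hf : ∀ k : Fin n, p ≤ (k : ℕ) → f k = 0) :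
    ∑ k : Fin n, f k = ∑ k : Fin p, f ⟨k, k.isLt.trans_le hpn⟩ := by
  obtain ⟨d, rfl⟩ := Nat.exists_eq_add_of_le hpn
  rw [Fin.sum_univ_add, Finset.sum_eq_zero (s := univ) (f := fun k => f (Fin.natAdd p k)), add_zero]
  · rfl
  · intro k _
    exact hf _ (by simp)

theorem det_one_sub_of_strictLower {n : ℕ} {B : Matrix (Fin n) (Fin n) ℝ}
    (hB : ∀ j k : Fin n, j ≤ k → B j k = 0) : (1 - B).det = 1 := by
  rw [det_of_isLowerTriangular]
  · simp [hB]
  · intro j k hjk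
    have hjk' : j < k := hjk
    simp [hB j k hjk'.le, hjk'.ne]

theorem inv_one_sub_mul_apply {n m : ℕ} {B : Matrix (Fin n) (Fin n) ℝ}
    (hB : ∀ j k : Fin n, j ≤ k → B j k = 0) (Ω : Matrix (Fin n) (Fin m) ℝ)
    (i : Fin m) (j : Fin n) :
    ((1 - B)⁻¹ * Ω) j i =
      (∑ k : Fin (j : ℕ), B j ⟨k, k.isLt.trans j.isLt⟩ *
        ((1 - B)⁻¹ * Ω) ⟨k, k.isLt.trans j.isLt⟩ i) + Ω j i := by
  have h : (1 - B) * ((1 - B)⁻¹ * Ω) = Ω :=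
    mul_nonsing_inv_cancel_left _ _ (by simp [det_one_sub_of_strictLower hB])
  have hji := congrFun (congrFun h j) i
  rw [Matrix.sub_mul, Matrix.one_mul, Matrix.sub_apply, Matrix.mul_apply (M := B),
    sum_fin_eq_sum_fin_of_le j.isLt.le _
      (fun k hk => by rw [hB j k (Fin.le_def.2 hk), zero_mul])] at hji
  linarith

/-- The values of `C` on any finite family of real vectors summing to the constant `ξ`
add up to the total effect. -/
theorem sum_C_eq {n m : ℕ} {B : Matrix (Fin n) (Fin n) ℝ}
    (hB : ∀ j k : Fin n, j ≤ k → B j k = 0) (Ω : Matrix (Fin n) (Fin m) ℝ)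
    (i : Fin m) (ξ : ℝ) {ι : Type*} [Fintype ι] (j : ℕ) (hj : j < n)
    (e : ι → Fin (2 ^ j) → ℝ) (hsum : ∀ t, ∑ a, e a t = ξ) :
    ∑ a, C B Ω i j hj (e a) = ξ * ((1 - B)⁻¹ * Ω) ⟨j, hj⟩ i := by
  induction j using Nat.strong_induction_on with
  | _ j ih =>
    rw [inv_one_sub_mul_apply hB]
    cases j with
    | zero =>
      simp only [C]
      rw [← Finset.mul_sum, hsum]
      simp [mul_comm]
    | succ j =>
      simp only [C]
      rw [Finset.sum_add_distrib, ← Finset.mul_sum, hsum, Finset.sum_comm, mul_add,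
        mul_comm ξ (Ω _ _), Finset.mul_sum]
      congr 1
      refine Finset.sum_congr rfl fun k _ => ?_
      rw [← Finset.mul_sum, ih k k.isLt _ _ fun t => hsum _]
      ring

/-- causal effects of `{0, ξ}`-valued assignment vectors that sum to
`ξ·𝟙` decompose the total impulse-response effect `ξ·Φ_{j,i}`, `Φ = (I−B)⁻¹Ω`. -/
theorem assignment_vectors_decompose_total_effect (n m : ℕ) (hn : 0 < n) (hm : 0 < m)
    (B : Matrix (Fin n) (Fin n) ℝ) (Ω : Matrix (Fin n) (Fin m) ℝ)
    (hB : ∀ j k : Fin n, j ≤ k → B j k = 0)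
    (i : Fin m) (j : Fin n) (ξ : ℝ)
    (k : ℕ) (e : Fin k → Fin (2 ^ (j : ℕ)) → ℝ)
    (he : ∀ a t, e a t = 0 ∨ e a t = ξ)
    (hsum : ∀ t, ∑ a : Fin k, e a t = ξ) :
    ∑ a : Fin k, C B Ω i (j : ℕ) j.isLt (e a) = ξ * ((1 - B)⁻¹ * Ω) j i :=
  sum_C_eq hB Ω i ξ j j.isLt e hsum

end TCA
end

section
/- (Invariance of Q-columns in the QL decomposition under block-preserving column permutations.) Let A be an invertible real K×K matrix, r ∈ {1,…,K}, and σ a permutation of {1,…,K} with σ(r) = r and σ({r+1,…,K}) = {r+1,…,K} (hence also σ({1,…,r−1}) = {1,…,r−1}). Let A∘σ be the matrix with columns (A∘σ)_{·,k} = A_{·,σ(k)}. If A = QL and A∘σ = Q′L′ are QL decompositions (Q, Q′ orthogonal; L, L′ lower triangular with strictly positive diagonal entries), then the r-th columns of Q and Q′ coincide: Q′_{·,r} = Q_{·,r}. -/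
open Matrix

/-- The position of `k` relative to `r`, in decreasing order: `2` if `k < r`, `1` if `k = r`,
`0` if `r < k`. -/
def pivotBlock {K : ℕ} (r k : Fin K) : ℕ :=
  if k < r then 2 else if k = r then 1 else 0

theorem lt_of_pivotBlock_lt {K : ℕ} {r i j : Fin K} (h : pivotBlock r j < pivotBlock r i) :
    i < j := by
  unfold pivotBlock at h
  split_ifs at h <;> omega

theorem pivotBlock_perm {K : ℕ} {r : Fin K} {σ : Equiv.Perm (Fin K)} (hσr : σ r = r)
    (hσ : ∀ k : Fin K, r < σ k ↔ r < k) (k : Fin K) :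
    pivotBlock r (σ k) = pivotBlock r k := by
  have h₁ := hσ k
  have h₂ : σ k = r ↔ k = r := by
    conv_lhs => rw [← hσr]
    exact σ.apply_eq_iff_eq
  unfold pivotBlock
  split_ifs <;> omega

/-- invariance of Q-columns of the QL decomposition under
block-preserving column permutations: if `σ` fixes `r` and maps `{r+1,…,K}`
onto itself (hence also `{1,…,r−1}` onto itself), then the `r`-th columns of
the orthogonal factors of `A` and of the column-permuted matrix `A∘σ`
coincide. -/
theorem ql_q_column_invariance (K : ℕ)
    (A Q L Q' L' : Matrix (Fin K) (Fin K) ℝ)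
    (hA : IsUnit A) (r : Fin K) (σ : Equiv.Perm (Fin K))
    (hσr : σ r = r) (hσ : ∀ k : Fin K, r < σ k ↔ r < k)
    (hQ : Qᵀ * Q = 1)
    (hL : ∀ i j : Fin K, i < j → L i j = 0) (hLd : ∀ i, 0 < L i i)
    (hQ' : Q'ᵀ * Q' = 1)
    (hL' : ∀ i j : Fin K, i < j → L' i j = 0) (hL'd : ∀ i, 0 < L' i i)
    (hdec : A = Q * L) (hdec' : A.submatrix id σ = Q' * L') :
    ∀ k : Fin K, Q' k r = Q k r := by
  have hLb : (L.submatrix id σ).BlockTriangular (pivotBlock r) := by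
    intro i j hij
    rw [← pivotBlock_perm hσr hσ j] at hij
    exact hL _ _ (lt_of_pivotBlock_lt hij)
  have hL'b : L'.BlockTriangular (pivotBlock r) :=
    fun i j hij => hL' _ _ (lt_of_pivotBlock_lt hij)
  have hdet : IsUnit L'.det := by
    rw [det_of_isLowerTriangular L' (fun i j hij => hL' i j hij)]
    exact (Finset.prod_pos fun i _ => hL'd i).ne'.isUnit
  have : Invertible L' := invertibleOfIsUnitDet _ hdet
  have hfac : Qᵀ * Q' * L' = L.submatrix id σ := by
    rw [Matrix.mul_assoc, ← hdec', hdec, ← Matrix.submatrix_mul_equiv Q L id (Equiv.refl _) σ]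
    simp [← Matrix.mul_assoc, hQ]
  obtain ⟨M, hM⟩ : ∃ M, M = Qᵀ * Q' := ⟨_, rfl⟩
  rw [← hM] at hfac
  have hQM : Q' = Q * M := by
    rw [hM, ← Matrix.mul_assoc, mul_eq_one_comm.mp hQ, Matrix.one_mul]
  have hMM : Mᵀ * M = 1 := by
    rw [hM, Matrix.transpose_mul, Matrix.transpose_transpose, Matrix.mul_assoc,
      ← Matrix.mul_assoc Q, mul_eq_one_comm.mp hQ, Matrix.one_mul, hQ']
  have hMb : M.BlockTriangular (pivotBlock r) := by
    have h : M = L.submatrix id σ * L'⁻¹ := by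
      rw [← hfac, Matrix.mul_assoc, Matrix.mul_nonsing_inv _ hdet, Matrix.mul_one]
    rw [h]
    exact hLb.mul (blockTriangular_inv_of_blockTriangular hL'b)
  have hMtb : Mᵀ.BlockTriangular (pivotBlock r) := by
    have : Invertible M := invertibleOfLeftInverse _ _ hMM
    rw [← Matrix.inv_eq_left_inv hMM]
    exact blockTriangular_inv_of_blockTriangular hMb
  have hcol : ∀ i, i ≠ r → M i r = 0 := by
    intro i hi
    rcases lt_or_gt_of_ne hi with h | h
    · exact hMb (by simp [pivotBlock, h])
    · exact hMtb (i := r) (j := i) (by simp [pivotBlock, h.not_gt, hi])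
  have hrow : ∀ j, r < j → M r j = 0 := fun j h =>
    hMb (by simp [pivotBlock, h.not_gt, h.ne'])
  have hdiag : M r r * L' r r = L r r := by
    have h := congrFun (congrFun hfac r) r
    rw [Matrix.mul_apply, Finset.sum_eq_single r] at h
    · simpa [hσr] using h
    · intro j _ hj
      rcases lt_or_gt_of_ne hj with hj | hj
      · rw [hL' _ _ hj, mul_zero]
      · rw [hrow j hj, zero_mul]
    · simp
  have hpos : 0 < M r r := pos_of_mul_pos_left (hdiag ▸ hLd r) (hL'd r).le
  have hsq : M r r * M r r = 1 := by
    have h := congrFun (congrFun hMM r) r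
    rw [Matrix.mul_apply, Finset.sum_eq_single r] at h
    · simpa using h
    · intro j _ hj
      rw [hcol j hj, mul_zero]
    · simp
  have hone : M r r = 1 := by nlinarith
  intro k
  rw [hQM, Matrix.mul_apply, Finset.sum_eq_single r]
  · rw [hone, mul_one]
  · intro j _ hj
    rw [hcol j hj, mul_zero]
  · simp
end

section
/- (Invariance of the re-parameterised shock loadings; Lemma 1 of the paper.) Let A be an invertible real K×K matrix, r ∈ {1,…,K}, and σ a permutation of {1,…,K} with σ(r) = r and σ({r+1,…,K}) = {r+1,…,K}. Let A∘σ be the matrix with columns (A∘σ)_{·,k} = A_{·,σ(k)}. Let A = QL and A∘σ = Q′L′ be QL decompositions (Q, Q′ orthogonal; L, L′ lower triangular with strictly positive diagonal entries), and set D := diag(L)^{-1} and D′ := diag(L′)^{-1}, where diag(X) denotes the diagonal matrix formed from the diagonal of X. Then the r-th rows of DQᵀ and D′(Q′)ᵀ coincide: (D′(Q′)ᵀ)_{r,·} = (DQᵀ)_{r,·}. -/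
open Matrix

/-- If `v ᵥ* L` vanishes beyond `r` and `L` is lower triangular with nonzero diagonal, then
`v` vanishes beyond `r`. -/
theorem eq_zero_of_vecMul_lowerTriangular {ι : Type*} [Fintype ι] [LinearOrder ι]
    {L : Matrix ι ι ℝ} (hL : ∀ i j, i < j → L i j = 0) (hLd : ∀ i, L i i ≠ 0)
    {v : ι → ℝ} {r : ι} (hv : ∀ j, r < j → (v ᵥ* L) j = 0) (j : ι) (hj : r < j) : v j = 0 := by
  induction j using WellFoundedGT.induction with
  | ind j ih =>
    have h := hv j hj
    rw [Matrix.vecMul, dotProduct, Finset.sum_eq_single j] at h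
    · exact (mul_eq_zero.mp h).resolve_right (hLd j)
    · intro i _ hij
      rcases lt_or_gt_of_ne hij with hlt | hgt
      · rw [hL i j hlt, mul_zero]
      · rw [ih i hgt (hj.trans hgt), zero_mul]
    · simp

/-- If `v` vanishes beyond `r` and `L` is lower triangular, the `r`-th entry of `v ᵥ* L` only
involves the `r`-th diagonal entry of `L`. -/
theorem vecMul_lowerTriangular_apply {ι : Type*} [Fintype ι] [LinearOrder ι]
    {L : Matrix ι ι ℝ} (hL : ∀ i j, i < j → L i j = 0)
    {v : ι → ℝ} {r : ι} (hv : ∀ j, r < j → v j = 0) : (v ᵥ* L) r = v r * L r r := by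
  rw [Matrix.vecMul, dotProduct, Finset.sum_eq_single r]
  · intro i _ hir
    rcases lt_or_gt_of_ne hir with hlt | hgt
    · rw [hL i r hlt, mul_zero]
    · rw [hv i hgt, zero_mul]
  · simp

/-- A row of a real matrix with `M * Mᵀ = 1` whose diagonal entry is `1` is a standard basis
vector. -/
theorem row_eq_single_of_mul_transpose_eq_one {ι : Type*} [Fintype ι] [DecidableEq ι]
    {M : Matrix ι ι ℝ} (hM : M * Mᵀ = 1) {r : ι} (hr : M r r = 1) :
    M r = Pi.single r 1 := by
  have hsum : ∑ j, M r j * M r j = 1 := by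
    simpa [Matrix.mul_apply] using congrFun (congrFun hM r) r
  rw [← Finset.add_sum_erase _ _ (Finset.mem_univ r), hr, one_mul, add_eq_left,
    Finset.sum_eq_zero_iff_of_nonneg fun j _ => mul_self_nonneg _] at hsum
  ext j
  by_cases hj : j = r
  · subst hj
    simp [hr]
  · rw [Pi.single_eq_of_ne hj]
    exact mul_self_eq_zero.mp (hsum j (by simp [hj]))

/-- invariance of the re-parameterised shock loadings, Lemma 1:
with `A = QL` and `A∘σ = Q\'L\'` QL decompositions, `D = diag(L)⁻¹`,
`D\' = diag(L\')⁻¹`, and `σ` fixing `r` and mapping `{r+1,…,K}` onto itself,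
the `r`-th rows of `DQᵀ` and `D\'(Q\')ᵀ` coincide. -/
theorem reparam_row_invariance (K : ℕ)
    (A Q L Q' L' : Matrix (Fin K) (Fin K) ℝ)
    (hA : IsUnit A) (r : Fin K) (σ : Equiv.Perm (Fin K))
    (hσr : σ r = r) (hσ : ∀ k : Fin K, r < σ k ↔ r < k)
    (hQ : Qᵀ * Q = 1)
    (hL : ∀ i j : Fin K, i < j → L i j = 0) (hLd : ∀ i, 0 < L i i)
    (hQ' : Q'ᵀ * Q' = 1)
    (hL' : ∀ i j : Fin K, i < j → L' i j = 0) (hL'd : ∀ i, 0 < L' i i)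
    (hdec : A = Q * L) (hdec' : A.submatrix id σ = Q' * L') :
    ∀ c : Fin K,
      ((Matrix.diagonal fun k => L' k k)⁻¹ * Q'ᵀ) r c
        = ((Matrix.diagonal fun k => L k k)⁻¹ * Qᵀ) r c := by
  have hQQ : Q * Qᵀ = 1 := mul_eq_one_comm.mp hQ
  have hQQ' : Q' * Q'ᵀ = 1 := mul_eq_one_comm.mp hQ'
  obtain ⟨M, hM⟩ : ∃ M, M = Q'ᵀ * Q := ⟨_, rfl⟩
  have hMT : Mᵀ = Qᵀ * Q' := by rw [hM, transpose_mul, transpose_transpose]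
  have hMM : M * Mᵀ = 1 := by
    rw [hMT, hM, Matrix.mul_assoc, ← Matrix.mul_assoc Q, hQQ, Matrix.one_mul, hQ']
  have hML : (M * L).submatrix id σ = L' := by
    have : (Q'ᵀ * A).submatrix id σ = Q'ᵀ * A.submatrix id σ := rfl
    rw [hM, Matrix.mul_assoc, ← hdec, this, hdec', ← Matrix.mul_assoc, hQ', Matrix.one_mul]
  have hML' : Mᵀ * L' = L.submatrix id σ := by
    have : (Qᵀ * A).submatrix id σ = Qᵀ * A.submatrix id σ := rfl
    rw [hMT, Matrix.mul_assoc, ← hdec', ← this, hdec, ← Matrix.mul_assoc, hQ, Matrix.one_mul]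
  have hrow (k : Fin K) : (M r ᵥ* L) (σ k) = L' r k := congrFun (congrFun hML r) k
  have hcol (k : Fin K) : (Mᵀ r ᵥ* L') k = L r (σ k) := congrFun (congrFun hML' r) k
  have hv : ∀ j, r < j → M r j = 0 :=
    eq_zero_of_vecMul_lowerTriangular hL (fun i => (hLd i).ne') fun j hj => by
      obtain ⟨k, rfl⟩ := σ.surjective j
      rw [hrow, hL' r k ((hσ k).mp hj)]
  have hv' : ∀ j, r < j → Mᵀ r j = 0 :=
    eq_zero_of_vecMul_lowerTriangular hL' (fun i => (hL'd i).ne') fun j hj => by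
      rw [hcol, hL r (σ j) ((hσ j).mpr hj)]
  have h1 : M r r * L r r = L' r r := by
    rw [← vecMul_lowerTriangular_apply hL hv, ← hrow r, hσr]
  have h2 : M r r * L' r r = L r r := by
    have := hcol r
    rwa [vecMul_lowerTriangular_apply hL' hv', hσr] at this
  have hMr : M r r = 1 := by
    have hpos : 0 < M r r := pos_of_mul_pos_left (h1 ▸ hL'd r) (hLd r).le
    have hsq : M r r * M r r = 1 := by
      apply mul_right_cancel₀ (hLd r).ne'
      rw [mul_assoc, h1, h2, one_mul]
    nlinarith
  have hd : L' r r = L r r := by rw [← h1, hMr, one_mul]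
  have hQr (c : Fin K) : Q'ᵀ r c = Qᵀ r c := by
    have hMQ : M * Qᵀ = Q'ᵀ := by rw [hM, Matrix.mul_assoc, hQQ, Matrix.mul_one]
    rw [← hMQ, Matrix.mul_apply_eq_vecMul, row_eq_single_of_mul_transpose_eq_one hMM hMr,
      Matrix.single_one_vecMul]
    rfl
  have hinv {d : Fin K → ℝ} (h : ∀ i, 0 < d i) : (diagonal d)⁻¹ = diagonal fun i => (d i)⁻¹ := by
    apply Matrix.inv_eq_right_inv
    simp [fun i => (h i).ne']
  intro c
  rw [hinv hL'd, hinv hLd, diagonal_mul, diagonal_mul, hd, hQr]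
end

section
/- (Invariance of the re-parameterised autoregressive coefficients; Lemma 2 of the paper.) Let A₀ and M be real K×K matrices with A₀ invertible, let r, c ∈ {1,…,K}, and let σ be a permutation of {1,…,K} with σ(r) = r, σ(c) = c, and σ mapping each of the sets {1,…,min(r,c)−1}, {min(r,c)+1,…,max(r,c)−1}, and {max(r,c)+1,…,K} onto itself. Let A₀∘σ and M∘σ denote column-permuted matrices ((X∘σ)_{·,k} = X_{·,σ(k)}). Let A₀ = QL and A₀∘σ = Q′L′ be QL decompositions (Q, Q′ orthogonal; L, L′ lower triangular with strictly positive diagonal), and set D := diag(L)^{-1}, D′ := diag(L′)^{-1}. Then (D′(Q′)ᵀ(M∘σ))_{r,c} = (DQᵀM)_{r,c}. -/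
open Matrix

theorem eq_zero_of_vecMul_lowerTriangular_s16 {K : ℕ} {L : Matrix (Fin K) (Fin K) ℝ}
    (hL : ∀ i j, i < j → L i j = 0) (hLd : ∀ i, 0 < L i i) (u : Fin K → ℝ)
    (p : Fin K → Prop) (hp : ∀ i j, i < j → p i → p j)
    (h : ∀ j, p j → ∑ k, u k * L k j = 0) : ∀ j, p j → u j = 0 := by
  intro j
  induction j using WellFoundedGT.induction with
  | ind j ih =>
    intro hj
    have hs := h j hj
    rw [Finset.sum_eq_single j] at hs
    · exact (mul_eq_zero.mp hs).resolve_right (hLd j).ne'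
    · intro k _ hk
      rcases lt_or_gt_of_ne hk with hk | hk
      · rw [hL k j hk, mul_zero]
      · rw [ih k hk (hp j k hk hj), zero_mul]
    · simp

theorem zero_pattern_of_mul_lowerTriangular {K : ℕ} {U L L' : Matrix (Fin K) (Fin K) ℝ}
    {σ : Equiv.Perm (Fin K)} {r : Fin K} (hσr : σ r = r) (hσ : ∀ k, r < k → r < σ k)
    (hL : ∀ i j, i < j → L i j = 0)
    (hL' : ∀ i j, i < j → L' i j = 0) (hL'd : ∀ i, 0 < L' i i)
    (h : U * L' = L.submatrix id σ) :
    (∀ j, r < j → U r j = 0) ∧ ∀ i, i < r → U i r = 0 := by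
  have hsum (i j : Fin K) : ∑ k, U i k * L' k j = L i (σ j) := by
    rw [← Matrix.mul_apply, h]; rfl
  constructor
  · refine eq_zero_of_vecMul_lowerTriangular_s16 hL' hL'd (U r) (fun j => r < j)
      (fun i j hij hi => hi.trans hij) fun j hj => ?_
    rw [hsum]
    exact hL _ _ (hσ j hj)
  · intro i hi
    refine eq_zero_of_vecMul_lowerTriangular_s16 hL' hL'd (U i) (fun j => r ≤ j)
      (fun i j hij hi => hi.trans hij.le) (fun j hj => ?_) r le_rfl
    rw [hsum]
    rcases hj.eq_or_lt with rfl | hj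
    · rw [hσr]; exact hL _ _ hi
    · exact hL _ _ (hi.trans (hσ j hj))

/-- invariance of the re-parameterised autoregressive coefficients,
Lemma 2: with `A₀ = QL` and `A₀∘σ = Q\'L\'` QL decompositions, `D = diag(L)⁻¹`,
`D\' = diag(L\')⁻¹`, and `σ` fixing `r` and `c` and mapping each of
`{1,…,min(r,c)−1}`, `{min(r,c)+1,…,max(r,c)−1}` and `{max(r,c)+1,…,K}` onto
itself, the `(r,c)` entries of `DQᵀM` and `D\'(Q\')ᵀ(M∘σ)` coincide. -/
theorem reparam_ar_invariance (K : ℕ)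
    (A₀ M Q L Q' L' : Matrix (Fin K) (Fin K) ℝ)
    (hA : IsUnit A₀) (r c : Fin K) (σ : Equiv.Perm (Fin K))
    (hσr : σ r = r) (hσc : σ c = c)
    (hσ1 : ∀ k : Fin K, σ k < min r c ↔ k < min r c)
    (hσ2 : ∀ k : Fin K, (min r c < σ k ∧ σ k < max r c) ↔ (min r c < k ∧ k < max r c))
    (hσ3 : ∀ k : Fin K, max r c < σ k ↔ max r c < k)
    (hQ : Qᵀ * Q = 1)
    (hL : ∀ i j : Fin K, i < j → L i j = 0) (hLd : ∀ i, 0 < L i i)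
    (hQ' : Q'ᵀ * Q' = 1)
    (hL' : ∀ i j : Fin K, i < j → L' i j = 0) (hL'd : ∀ i, 0 < L' i i)
    (hdec : A₀ = Q * L) (hdec' : A₀.submatrix id σ = Q' * L') :
    ((Matrix.diagonal fun k => L' k k)⁻¹ * Q'ᵀ * M.submatrix id σ) r c
      = ((Matrix.diagonal fun k => L k k)⁻¹ * Qᵀ * M) r c := by
  have hσ (k : Fin K) : r < σ k ↔ r < k := by
    have h1 := hσ1 k
    have h2 := hσ2 k
    have h3 := hσ3 k
    have hr : σ k = r ↔ k = r := by
      constructor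
      · intro h; exact σ.injective (h.trans hσr.symm)
      · rintro rfl; exact hσr
    have hc : σ k = c ↔ k = c := by
      constructor
      · intro h; exact σ.injective (h.trans hσc.symm)
      · rintro rfl; exact hσc
    rcases le_total r c with hrc | hrc
    · simp only [min_eq_left hrc] at h1
      grind
    · simp only [max_eq_left hrc] at h3
      exact h3
  have hQQ : Q * Qᵀ = 1 := mul_eq_one_comm.mp hQ
  have hA' : A₀.submatrix id σ = Q * L.submatrix id σ := by
    rw [hdec]; ext i j; simp [Matrix.mul_apply]
  have hU : Qᵀ * Q' * L' = L.submatrix id σ := by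
    rw [Matrix.mul_assoc, ← hdec', hA', ← Matrix.mul_assoc, hQ, Matrix.one_mul]
  have hV : Q'ᵀ * Q * L = L'.submatrix id σ.symm := by
    have : Q * L = Q' * L'.submatrix id σ.symm := by
      have h := congrArg (fun X => X.submatrix id σ.symm) hdec'
      rw [← hdec]
      ext i j
      simpa [Matrix.mul_apply] using congrFun (congrFun h i) j
    rw [Matrix.mul_assoc, this, ← Matrix.mul_assoc, hQ', Matrix.one_mul]
  obtain ⟨hrow, hcol⟩ := zero_pattern_of_mul_lowerTriangular hσr (fun k => (hσ k).mpr)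
    hL hL' hL'd hU
  obtain ⟨hrow', -⟩ := zero_pattern_of_mul_lowerTriangular (σ := σ.symm)
    (σ.symm_apply_eq.mpr hσr.symm)
    (fun k hk => (hσ _).mp (by simpa using hk)) hL' hL hLd hV
  have htr : Q'ᵀ * Q = (Qᵀ * Q')ᵀ := by simp
  rw [htr] at hrow'
  have hUU : (Qᵀ * Q')ᵀ * (Qᵀ * Q') = 1 := by
    rw [← htr, Matrix.mul_assoc, ← Matrix.mul_assoc Q, hQQ, Matrix.one_mul, hQ']
  have hQU : Q' = Q * (Qᵀ * Q') := by rw [← Matrix.mul_assoc, hQQ, Matrix.one_mul]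
  generalize Qᵀ * Q' = U at hU hrow hcol hrow' hUU hQU
  have hoff (i : Fin K) (hi : i ≠ r) : U i r = 0 := by
    rcases lt_or_gt_of_ne hi with hi | hi
    · exact hcol i hi
    · exact hrow' i hi
  have hrr : U r r * L' r r = L r r := by
    have h := congrFun (congrFun hU r) r
    rw [Matrix.mul_apply, Finset.sum_eq_single r] at h
    · simpa [hσr] using h
    · intro k _ hk
      rcases lt_or_gt_of_ne hk with hk | hk
      · rw [hL' k r hk, mul_zero]
      · rw [hrow k hk, zero_mul]
    · simp
  have hsq : U r r * U r r = 1 := by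
    have h := congrFun (congrFun hUU r) r
    rw [Matrix.mul_apply, Finset.sum_eq_single r] at h
    · simpa using h
    · intro k _ hk
      rw [hoff k hk, mul_zero]
    · simp
  have hpos : 0 < U r r := pos_of_mul_pos_left (hrr ▸ hLd r) (hL'd r).le
  have hone : U r r = 1 := by nlinarith
  have hLrr : L' r r = L r r := by rw [← hrr, hone, one_mul]
  have hQr (i : Fin K) : Q' i r = Q i r := by
    rw [hQU, Matrix.mul_apply, Finset.sum_eq_single r]
    · rw [hone, mul_one]
    · intro k _ hk
      rw [hoff k hk, mul_zero]
    · simp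
  have hinv (X : Matrix (Fin K) (Fin K) ℝ) (hX : ∀ i, 0 < X i i) :
      (Matrix.diagonal fun k => X k k)⁻¹ = Matrix.diagonal fun k => (X k k)⁻¹ := by
    apply Matrix.inv_eq_right_inv
    rw [Matrix.diagonal_mul_diagonal, ← Matrix.diagonal_one]
    congr 1
    funext k
    exact mul_inv_cancel₀ (hX k).ne'
  rw [hinv L hLd, hinv L' hL'd, Matrix.mul_assoc, Matrix.mul_assoc,
    Matrix.diagonal_mul, Matrix.diagonal_mul, hLrr]
  simp [Matrix.mul_apply, hQr, hσc]
end

section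
/- (Invariance of Cholesky-orthogonalised impulse responses; Lemma 3 of the paper, cf. Christiano–Eichenbaum–Evans.) Let Σ be a real positive definite K×K matrix, c ∈ {1,…,K}, and σ a permutation of {1,…,K} with σ(c) = c and σ({1,…,c−1}) = {1,…,c−1} (hence σ({c+1,…,K}) = {c+1,…,K}). Let P be the K×K permutation matrix with P_{k,l} = 1 if l = σ(k) and 0 otherwise, so that (PΣPᵀ)_{k,l} = Σ_{σ(k),σ(l)}. Let L and L̃ be the Cholesky factors of Σ and PΣPᵀ respectively. Then for every k ∈ {1,…,K}, L̃_{k,c} = L_{σ(k),c}; that is, the c-th column of the Cholesky factor is invariant, up to the relabeling of the other variables, to re-ordering the variables before c among themselves and the variables after c among themselves. -/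
open Matrix

/-- A lower triangular `L` with positive diagonal determines, for each `c`, a vector `v` supported
on `{i | i ≤ c}` with `v c = 1` such that `v ᵥ* (L * Lᵀ)` is `L c c` times the `c`-th column
of `L`. -/
theorem exists_vecMul_cholesky_eq_smul_col {n : Type*} [Fintype n] [LinearOrder n]
    (L : Matrix n n ℝ) (hL : ∀ i j, i < j → L i j = 0) (hpos : ∀ i, 0 < L i i) (c : n) :
    ∃ v : n → ℝ, v c = 1 ∧ (∀ i, c < i → v i = 0) ∧
      ∀ k, (v ᵥ* (L * Lᵀ)) k = L c c * L k c := by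
  have htri : L.BlockTriangular OrderDual.toDual := fun i j h ↦ hL i j h
  have hdet : IsUnit L.det := by
    rw [det_of_isLowerTriangular L htri]
    exact (Finset.prod_pos fun i _ ↦ hpos i).ne'.isUnit
  have : Invertible L := L.invertibleOfIsUnitDet hdet
  have hinv : ∀ i, c < i → L⁻¹ c i = 0 := fun i hi ↦
    blockTriangular_inv_of_blockTriangular htri hi
  have hmul : L⁻¹ * L = 1 := L.nonsing_inv_mul hdet
  refine ⟨L c c • L⁻¹ c, ?_, fun i hi ↦ by simp [hinv i hi], fun k ↦ ?_⟩
  · have h : (L⁻¹ * L) c c = 1 := by simp [hmul]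
    rw [mul_apply, Finset.sum_eq_single c] at h
    · simpa [mul_comm] using h
    · intro i _ hi
      rcases lt_or_gt_of_ne hi with hi | hi
      · simp [hL i c hi]
      · simp [hinv i hi]
    · simp
  · have h : L⁻¹ c ᵥ* (L * Lᵀ) = fun k ↦ L k c := by
      ext k
      change (L⁻¹ * (L * Lᵀ)) c k = _
      rw [← mul_assoc, hmul, one_mul, transpose_apply]
    rw [smul_vecMul, h, Pi.smul_apply, smul_eq_mul]

/-- For positive definite `S`, a vector `v` supported on `{i | i ≤ c}` with prescribed `v c` and
`(v ᵥ* S) i = 0` for `i < c` is unique. -/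
theorem Matrix.PosDef.eq_of_vecMul_eq_zero_of_lt {n : Type*} [Fintype n] [LinearOrder n]
    {S : Matrix n n ℝ} (hS : S.PosDef) {c : n} {v w : n → ℝ} (hc : v c = w c)
    (hv : ∀ i, c < i → v i = 0) (hw : ∀ i, c < i → w i = 0)
    (hvS : ∀ i, i < c → (v ᵥ* S) i = 0) (hwS : ∀ i, i < c → (w ᵥ* S) i = 0) : v = w := by
  by_contra hne
  have hpos := hS.dotProduct_mulVec_pos (sub_ne_zero.mpr hne)
  rw [star_trivial, dotProduct_mulVec, sub_vecMul] at hpos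
  refine hpos.ne' (Finset.sum_eq_zero fun i _ ↦ ?_)
  rcases lt_trichotomy i c with hi | rfl | hi
  · simp [hvS i hi, hwS i hi]
  · simp [hc]
  · simp [hv i hi, hw i hi]

/-- invariance of Cholesky-orthogonalised impulse responses,
Lemma 3: for positive definite `S`, a permutation `σ` fixing `c` and mapping
`{1,…,c−1}` onto itself (hence `{c+1,…,K}` onto itself), the permutation matrix
`P` with `P_{k,l} = 1` iff `l = σ k`, and Cholesky factors `L` of `S` and `Lt`
of `PSPᵀ`, one has `Lt_{k,c} = L_{σ k, c}` for every `k`. -/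
theorem cholesky_column_invariance (K : ℕ)
    (S : Matrix (Fin K) (Fin K) ℝ) (hS : S.PosDef)
    (c : Fin K) (σ : Equiv.Perm (Fin K))
    (hσc : σ c = c) (hσ : ∀ k : Fin K, σ k < c ↔ k < c)
    (P : Matrix (Fin K) (Fin K) ℝ)
    (hP : ∀ k l : Fin K, P k l = if l = σ k then 1 else 0)
    (L Lt : Matrix (Fin K) (Fin K) ℝ)
    (hL1 : S = L * Lᵀ)
    (hL2 : ∀ i j : Fin K, i < j → L i j = 0) (hL3 : ∀ i, 0 < L i i)
    (hLt1 : P * S * Pᵀ = Lt * Ltᵀ)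
    (hLt2 : ∀ i j : Fin K, i < j → Lt i j = 0) (hLt3 : ∀ i, 0 < Lt i i) :
    ∀ k : Fin K, Lt k c = L (σ k) c := by
  have hT : P * S * Pᵀ = S.submatrix σ σ := by
    ext i j
    simp [mul_apply, hP]
  have hgt : ∀ k, c < k → c < σ k := fun k hk ↦
    lt_of_le_of_ne (not_lt.mp fun h ↦ hk.not_gt ((hσ k).mp h))
      fun h ↦ hk.ne (σ.injective (hσc.trans h))
  obtain ⟨v, hvc, hv, hvS⟩ := exists_vecMul_cholesky_eq_smul_col L hL2 hL3 c
  obtain ⟨w, hwc, hw, hwS⟩ := exists_vecMul_cholesky_eq_smul_col Lt hLt2 hLt3 c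
  rw [← hL1] at hvS
  rw [← hLt1, hT] at hwS
  have hvT : ∀ k, ((v ∘ σ) ᵥ* S.submatrix σ σ) k = L c c * L (σ k) c := by
    intro k
    rw [← hvS, submatrix_vecMul_equiv]
    simp [Function.comp_assoc]
  have hvw : v ∘ σ = w :=
    (hS.submatrix σ.injective).eq_of_vecMul_eq_zero_of_lt (c := c)
      (by simp [hσc, hvc, hwc]) (fun i hi ↦ hv _ (hgt i hi)) hw
      (fun i hi ↦ by rw [hvT, hL2 _ _ ((hσ i).mpr hi), mul_zero])
      (fun i hi ↦ by rw [hwS, hLt2 _ _ hi, mul_zero])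
  have hcol : ∀ k, Lt c c * Lt k c = L c c * L (σ k) c := fun k ↦ by
    rw [← hwS, ← hvw, hvT]
  have hdiag : Lt c c = L c c := by
    have h := hcol c
    rw [hσc] at h
    exact (mul_self_inj (hLt3 c).le (hL3 c).le).mp h
  intro k
  have h := hcol k
  rw [hdiag] at h
  exact mul_left_cancel₀ (hL3 c).ne' h
end

section
/- (Sufficiency of impulse responses and single-shock identification; Theorems 3(ii) and 4 of the paper in the SVAR case.) Let B and B′ be strictly lower triangular real n×n matrices, D and D′ invertible diagonal real n×n matrices, and Ω, Ω′ real n×m matrices. Suppose the Cholesky impulse responses agree, (I−B)^{-1}D = (I−B′)^{-1}D′, and the structural impulse responses to shock i agree, ((I−B)^{-1}Ω)_{·,i} = ((I−B′)^{-1}Ω′)_{·,i}. Then B = B′, D = D′, and Ω_{·,i} = Ω′_{·,i}; consequently, for every j ∈ {1,…,n}, every ξ ∈ ℝ, and every set P of paths from ε_i to x_j, the transmission effect Q_ξ(P) computed with (B,Ω) equals the transmission effect Q_ξ(P) computed with (B′,Ω′). In particular, all transmission effects of shock i are determined by the impulse response matrices (I−B)^{-1}D and ((I−B)^{-1}Ω)_{·,i},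 so only the i-th column of the structural impulse responses needs to be identified. -/
open Matrix Finset

namespace TCA

variable {n m : ℕ}

/-- `1 - B` has unit determinant when `B` is strictly lower triangular. -/
theorem isUnit_det_one_sub {B : Matrix (Fin n) (Fin n) ℝ}
    (hB : ∀ j k : Fin n, j ≤ k → B j k = 0) : IsUnit (1 - B).det := by
  rw [Matrix.det_of_isLowerTriangular]
  · simp [hB _ _ le_rfl]
  · intro j k hjk
    have hlt : j < k := hjk
    simp [hB j k hlt.le, hlt.ne]

/-- The factorisation of an impulse response matrix through a strictly lower triangular `B` and
an invertible diagonal `D` is unique. -/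
theorem cholesky_irf_injective {B B' D D' : Matrix (Fin n) (Fin n) ℝ}
    (hB : ∀ j k : Fin n, j ≤ k → B j k = 0)
    (hB' : ∀ j k : Fin n, j ≤ k → B' j k = 0)
    (hD : D.IsDiag) (hDu : IsUnit D) (hD' : D'.IsDiag) (hD'u : IsUnit D')
    (hchol : (1 - B)⁻¹ * D = (1 - B')⁻¹ * D') : B = B' ∧ D = D' := by
  have hU := isUnit_det_one_sub hB
  have hU' := isUnit_det_one_sub hB'
  have hDd := (Matrix.isUnit_iff_isUnit_det D).1 hDu
  have hDd' := (Matrix.isUnit_iff_isUnit_det D').1 hD'u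
  have hinv : D⁻¹ * (1 - B) = D'⁻¹ * (1 - B') := by
    have h := congrArg (·⁻¹) hchol
    simpa only [Matrix.mul_inv_rev, Matrix.nonsing_inv_nonsing_inv _ hU,
      Matrix.nonsing_inv_nonsing_inv _ hU'] using h
  have hDinv : D⁻¹ = D'⁻¹ := by
    rw [← hD.diagonal_diag, ← hD'.diagonal_diag, Matrix.inv_diagonal, Matrix.inv_diagonal] at hinv ⊢
    congr 1
    funext j
    simpa [Matrix.diagonal_mul, hB j j le_rfl, hB' j j le_rfl] using congrFun (congrFun hinv j) j
  have hDD : D = D' := Matrix.inv_inj hDinv hDd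
  subst hDD
  refine ⟨?_, rfl⟩
  have h := congrArg (D * ·) hinv
  simpa only [Matrix.mul_nonsing_inv_cancel_left _ _ hDd, sub_right_inj] using h

/-- Path weights depend on `Ω` only through its `i`-th column. -/
theorem wShock_congr (B : Matrix (Fin n) (Fin n) ℝ) {Ω Ω' : Matrix (Fin n) (Fin m) ℝ} {i : Fin m}
    (h : ∀ r, Ω r i = Ω' r i) : wShock B Ω i = wShock B Ω' i := by
  funext S
  unfold wShock
  cases S.sort (· ≤ ·) <;> simp [shockListWeight, h]

/-- IRF sufficiency and single-shock identification, SVAR case: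
if the Cholesky impulse responses `(I−B)⁻¹D` and the structural impulse responses
to shock `i` agree across two parameterisations, then `B = B'`, `D = D'`, the
`i`-th columns of `Ω` and `Ω'` agree, and every transmission effect of shock `i`
agrees. -/
theorem irf_sufficiency_single_shock (n m : ℕ) (hn : 0 < n) (hm : 0 < m)
    (B B' D D' : Matrix (Fin n) (Fin n) ℝ)
    (Ω Ω' : Matrix (Fin n) (Fin m) ℝ)
    (hB : ∀ j k : Fin n, j ≤ k → B j k = 0)
    (hB' : ∀ j k : Fin n, j ≤ k → B' j k = 0)
    (hD : D.IsDiag) (hDu : IsUnit D) (hD' : D'.IsDiag) (hD'u : IsUnit D')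
    (i : Fin m)
    (hchol : (1 - B)⁻¹ * D = (1 - B')⁻¹ * D')
    (hirf : ∀ r : Fin n, ((1 - B)⁻¹ * Ω) r i = ((1 - B')⁻¹ * Ω') r i) :
    B = B' ∧ D = D' ∧ (∀ r : Fin n, Ω r i = Ω' r i) ∧
      ∀ (j : Fin n) (ξ : ℝ) (P : Finset (Finset (Fin n))), P ⊆ allPathsTo j →
        Q ξ (wShock B Ω i) P = Q ξ (wShock B' Ω' i) P := by
  obtain ⟨rfl, rfl⟩ := cholesky_irf_injective hB hB' hD hDu hD' hD'u hchol
  have hU := isUnit_det_one_sub hB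
  have hcol : (1 - B)⁻¹ *ᵥ Ω.col i = (1 - B)⁻¹ *ᵥ Ω'.col i := funext hirf
  have hΩ : ∀ r, Ω r i = Ω' r i := by
    have h := congrArg ((1 - B) *ᵥ ·) hcol
    simp only [Matrix.mulVec_mulVec, Matrix.mul_nonsing_inv _ hU, Matrix.one_mulVec] at h
    exact congrFun h
  refine ⟨rfl, rfl, hΩ, fun j ξ P _ => ?_⟩
  rw [wShock_congr B hΩ]

end TCA
end
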